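/- If in the definition of value-stability the function φ(n,ε) is allowed to depend additionally on the past history z_{<k}, then the self-optimizing theorem fails: there exists a countable class of (deterministic, explorable) environments each satisfying this history-dependent relaxation of value-stability (with d(k,ε) ≡ 0), for which no self-optimizing policy exists. -/

import Mathlib

open MeasureTheory Filter Finset Asymptotics
open scoped ENNReal Classical

noncomputable section

namespace RL

/-- A perception `x = (r, o)`: a reward `r ∈ R = {0, …, r_max}` together with an
observation `o ∈ O`. -/
abbrev Percept (O : Type) (rmax : ℕ) := Fin (rmax + 1) × O

/-- A cycle `z = (y, r, o)`: an action together with the resulting perception. -/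
abbrev Cycle (Y O : Type) (rmax : ℕ) := Y × Percept O rmax

/-- A deterministic policy maps a history `z_{<k}` to the next action `y_k`. -/
abbrev Policy (Y O : Type) (rmax : ℕ) := List (Cycle Y O rmax) → Y

/-- An infinite interaction sequence. -/
abbrev Traj (Y O : Type) (rmax : ℕ) := ℕ → Cycle Y O rmax

instance (Y O : Type) (rmax : ℕ) : MeasurableSpace (Cycle Y O rmax) := ⊤

/-- The reward of a cycle `z = (y, (r, o))`, as a real number. -/
def rew {Y O : Type} {rmax : ℕ} (z : Cycle Y O rmax) : ℝ := ((z.2.1 : ℕ) : ℝ)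

/-- The cylinder set of all infinite sequences extending the finite sequence `l`. -/
def cylSet {A : Type} (l : List A) : Set (ℕ → A) := {ω | ∀ i : Fin l.length, ω i.1 = l.get i}

/-- An environment: conditional probabilities `ν(x_k | z_{<k} y_k)` of the next perception
given the history, together with, for each (deterministic) policy `p`, the induced
probability measure on interaction sequences, which on cylinder sets is given by the
product of the conditional probabilities (actions being forced by the policy). -/
structure Environment (Y O : Type) [Fintype Y] [Fintype O] (rmax : ℕ) where
  cond : List (Cycle Y O rmax) → Y → Percept O rmax → ℝ
  cond_nonneg : ∀ h y x, 0 ≤ cond h y x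
  cond_sum_one : ∀ h y, ∑ x : Percept O rmax, cond h y x = 1
  P : Policy Y O rmax → Measure (Traj Y O rmax)
  P_prob : ∀ p, IsProbabilityMeasure (P p)
  P_cyl : ∀ (p : Policy Y O rmax) (h : List (Cycle Y O rmax)) (z : Cycle Y O rmax),
    P p (cylSet (h ++ [z]))
      = P p (cylSet h) * ENNReal.ofReal (if z.1 = p h then cond h z.1 z.2 else 0)

variable {Y O : Type} [Fintype Y] [Fintype O] {rmax : ℕ}

/-- The average reward `(1/m) r_{1..m}` of the first `m` steps of a trajectory. -/
def avg {Y O : Type} {rmax : ℕ} (ω : Traj Y O rmax) (m : ℕ) : ℝ :=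
  (∑ i ∈ Finset.range m, rew (ω i)) / m

/-- `V(ν,p) = V` : the average limiting value exists a.s. and equals the constant `V`. -/
def ValueIs (ν : Environment Y O rmax) (p : Policy Y O rmax) (V : ℝ) : Prop :=
  ν.P p {ω | Tendsto (avg ω) atTop (nhds V)} = 1

/-- `V̄(ν,p) = V` : the upper limiting average value is a.s. the constant `V`. -/
def UpperValueIs (ν : Environment Y O rmax) (p : Policy Y O rmax) (V : ℝ) : Prop :=
  ν.P p {ω | limsup (avg ω) atTop = V} = 1

/-- `V` is the optimal value `V*_ν` of `ν`: some policy `p_ν` achieves average value `V`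
a.s., and every policy has upper average value `≤ V` a.s. -/
def IsOptimalValue (ν : Environment Y O rmax) (V : ℝ) : Prop :=
  ∃ p, ValueIs ν p V ∧ ∀ q : Policy Y O rmax, ν.P q {ω | limsup (avg ω) atTop ≤ V} = 1

/-- An environment is explorable if it has an optimal value `V*_ν`. -/
def Explorable (ν : Environment Y O rmax) : Prop := ∃ V, IsOptimalValue ν V

/-- `V` is the upper optimal value `V̄*_ν` of `ν`. -/
def IsUpperOptimalValue (ν : Environment Y O rmax) (V : ℝ) : Prop :=
  ∃ p, UpperValueIs ν p V ∧ ∀ q : Policy Y O rmax, ν.P q {ω | limsup (avg ω) atTop ≤ V} = 1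

/-- An environment is upper explorable if it has an upper optimal value `V̄*_ν`. -/
def UpperExplorable (ν : Environment Y O rmax) : Prop := ∃ V, IsUpperOptimalValue ν V

/-- `ν(x_{<k} | y_{<k})` : the probability of the perceptions of the history `h`,
given its actions. -/
def histProbX (ν : Environment Y O rmax) (h : List (Cycle Y O rmax)) : ℝ :=
  ∏ i : Fin h.length, ν.cond (h.take i.1) (h.get i).1 (h.get i).2

/-- Replace the first `k-1` actions of the policy `p` by the actions `y_{<k}` of the
history `h`. -/
def replacePolicy (h : List (Cycle Y O rmax)) (p : Policy Y O rmax) : Policy Y O rmax :=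
  fun l => if hl : l.length < h.length then (h.get ⟨l.length, hl⟩).1 else p l

/-- The measure induced by `(p, ν)` conditional on the history `h = z_{<k}`:
`ν`-probabilities conditional on `x_{<k}`, with the first `k-1` actions of `p`
replaced by `y_{<k}`. -/
def condMeasure (ν : Environment Y O rmax) (p : Policy Y O rmax)
    (h : List (Cycle Y O rmax)) : Measure (Traj Y O rmax) :=
  ProbabilityTheory.cond (ν.P (replacePolicy h p)) (cylSet h)

/-- `P( · | z_{<k})` under policy `p` in environment `ν`. -/
def condProb (ν : Environment Y O rmax) (p : Policy Y O rmax)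
    (h : List (Cycle Y O rmax)) (A : Set (Traj Y O rmax)) : ℝ≥0∞ :=
  condMeasure ν p h A

/-- `V(ν,p,z_{<k}) = V` : conditional on `z_{<k}`, the average limiting value is a.s. `V`. -/
def CondValueIs (ν : Environment Y O rmax) (p : Policy Y O rmax)
    (h : List (Cycle Y O rmax)) (V : ℝ) : Prop :=
  condProb ν p h {ω | Tendsto (avg ω) atTop (nhds V)} = 1

/-- `V̄(ν,p,z_{<k}) = V` : conditional on `z_{<k}`, the upper limiting average value
is a.s. `V`. -/
def CondUpperValueIs (ν : Environment Y O rmax) (p : Policy Y O rmax)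
    (h : List (Cycle Y O rmax)) (V : ℝ) : Prop :=
  condProb ν p h {ω | limsup (avg ω) atTop = V} = 1

/-- `V` is the conditional optimal value `V*_ν(z_{<k})`. -/
def IsCondOptimalValue (ν : Environment Y O rmax) (h : List (Cycle Y O rmax)) (V : ℝ) : Prop :=
  ∃ p, CondValueIs ν p h V ∧
    ∀ q : Policy Y O rmax, condProb ν q h {ω | limsup (avg ω) atTop ≤ V} = 1

/-- `V` is the conditional upper optimal value `V̄*_ν(z_{<k})`. -/
def IsCondUpperOptimalValue (ν : Environment Y O rmax) (h : List (Cycle Y O rmax)) (V : ℝ) :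
    Prop :=
  ∃ p, CondUpperValueIs ν p h V ∧
    ∀ q : Policy Y O rmax, condProb ν q h {ω | limsup (avg ω) atTop ≤ V} = 1

/-- Strongly explorable: after any history of positive probability there is a conditionally
optimal value. -/
def StronglyExplorable (ν : Environment Y O rmax) : Prop :=
  ∀ h, 0 < histProbX ν h → ∃ V, IsCondOptimalValue ν h V

/-- Strongly upper explorable. -/
def StronglyUpperExplorable (ν : Environment Y O rmax) : Prop :=
  ∀ h, 0 < histProbX ν h → ∃ V, IsCondUpperOptimalValue ν h V

/-- The worst-case optimal value `W*_ν = inf_{z_{<k}} V*_ν(z_{<k})`. -/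
def Wstar (ν : Environment Y O rmax) : ℝ :=
  sInf {V | ∃ h, 0 < histProbX ν h ∧ IsCondOptimalValue ν h V}

/-- The worst-case upper optimal value `W̄*_ν = inf_{z_{<k}} V̄*_ν(z_{<k})`. -/
def WstarUpper (ν : Environment Y O rmax) : ℝ :=
  sInf {V | ∃ h, 0 < histProbX ν h ∧ IsCondUpperOptimalValue ν h V}

/-- Recoverable: after any history of positive probability, some policy attains the
upper optimal value `V̄*_ν` with conditional probability 1. -/
def Recoverable (ν : Environment Y O rmax) : Prop :=
  ∃ V, IsUpperOptimalValue ν V ∧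
    ∀ h, 0 < histProbX ν h →
      ∃ p, condProb ν p h {ω | limsup (avg ω) atTop = V} = 1

/-- The quantitative part of value-stability, with target value `W`:
rewards `r_i ∈ [0, r_max]` with `(1/n) r_{1..n} → W`, `d(k,ε) = o(k)`,
`Σ_n φ(n,ε) < ∞`, and from any history `z_{<k}` some policy `p` recovers:
`P( r_{k..k+n} − r^{pν}_{k..k+n} > d(k,ε) + nε | z_{<k} ) ≤ φ(n,ε)`. -/
def ValueStableCore (ν : Environment Y O rmax) (W : ℝ) (r : ℕ → ℝ)
    (d : ℕ → ℝ → ℝ) (φ : ℕ → ℝ → ℝ) : Prop :=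
  (∀ i, r i ∈ Set.Icc (0 : ℝ) (rmax : ℝ)) ∧
  Tendsto (fun n => (∑ i ∈ Finset.range n, r i) / n) atTop (nhds W) ∧
  (∀ ε : ℝ, 0 < ε → (fun k : ℕ => d k ε) =o[atTop] fun k : ℕ => (k : ℝ)) ∧
  (∀ ε : ℝ, 0 < ε → Summable fun n => φ n ε) ∧
  ∀ h : List (Cycle Y O rmax), ∃ p : Policy Y O rmax, ∀ ε : ℝ, 0 < ε → ∀ n : ℕ,
    condProb ν p h
      {ω | d h.length ε + n * ε <
        (∑ i ∈ Finset.Icc h.length (h.length + n), r i)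
          - ∑ i ∈ Finset.Icc h.length (h.length + n), rew (ω i)}
      ≤ ENNReal.ofReal (φ n ε)

/-- Value-stability with explicit witnesses `V = V*_ν`, `r`, `d`, `φ`. -/
def ValueStableWith (ν : Environment Y O rmax) (V : ℝ) (r : ℕ → ℝ)
    (d : ℕ → ℝ → ℝ) (φ : ℕ → ℝ → ℝ) : Prop :=
  IsOptimalValue ν V ∧ ValueStableCore ν V r d φ

/-- A value-stable environment. -/
def ValueStable (ν : Environment Y O rmax) : Prop :=
  ∃ V r d φ, ValueStableWith ν V r d φ

/-- A worst-case value-stable environment: strongly explorable, and the value-stability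
condition holds with target `W*_ν`. -/
def WorstCaseValueStable (ν : Environment Y O rmax) : Prop :=
  StronglyExplorable ν ∧ ∃ r d φ, ValueStableCore ν (Wstar ν) r d φ

/-- A policy is self-optimizing for a class `C` if it attains the optimal value `V*_ν`
in every `ν ∈ C`. -/
def SelfOptimizing (p : Policy Y O rmax) (C : Set (Environment Y O rmax)) : Prop :=
  ∀ ν ∈ C, ∀ V, IsOptimalValue ν V → ValueIs ν p V

/-- A policy is upper self-optimizing for a class `C` if it attains the upper optimal
value `V̄*_ν` in every `ν ∈ C`. -/
def UpperSelfOptimizing (p : Policy Y O rmax) (C : Set (Environment Y O rmax)) : Prop :=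
  ∀ ν ∈ C, ∀ V, IsUpperOptimalValue ν V → UpperValueIs ν p V

/-- A deterministic environment: all conditional probabilities are `0` or `1`. -/
def Deterministic (ν : Environment Y O rmax) : Prop :=
  ∀ h y x, ν.cond h y x = 0 ∨ ν.cond h y x = 1

/-- In a deterministic environment, the perception following history `h` and action `y`. -/
def pick [Nonempty O] (ν : Environment Y O rmax) (h : List (Cycle Y O rmax)) (y : Y) :
    Percept O rmax :=
  if hx : ∃ x, ν.cond h y x = 1 then hx.choose else Classical.arbitrary _

/-- The (deterministic) history generated by policy `p` in a deterministic environment. -/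
def detHist [Nonempty O] (ν : Environment Y O rmax) (p : Policy Y O rmax) :
    ℕ → List (Cycle Y O rmax)
  | 0 => []
  | n + 1 =>
      detHist ν p n ++ [(p (detHist ν p n), pick ν (detHist ν p n) (p (detHist ν p n)))]

/-- The cycle `z_n` generated by policy `p` in a deterministic environment. -/
def detZ [Nonempty O] (ν : Environment Y O rmax) (p : Policy Y O rmax) (n : ℕ) :
    Cycle Y O rmax :=
  (p (detHist ν p n), pick ν (detHist ν p n) (p (detHist ν p n)))

end RL

namespace RL

/-- The history-dependent relaxation of value-stability, with `d(k,ε) ≡ 0`: the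
function `φ` is allowed to depend additionally on the past history `z_{<k}`. -/
def ValueStableRelaxed {Y O : Type} [Fintype Y] [Fintype O] {rmax : ℕ}
    (ν : Environment Y O rmax) : Prop :=
  ∃ (V : ℝ) (r : ℕ → ℝ) (φ : ℕ → ℝ → List (Cycle Y O rmax) → ℝ),
    IsOptimalValue ν V ∧
    (∀ i, r i ∈ Set.Icc (0 : ℝ) (rmax : ℝ)) ∧
    Tendsto (fun n => (∑ i ∈ Finset.range n, r i) / n) atTop (nhds V) ∧
    (∀ (ε : ℝ), 0 < ε → ∀ h, Summable fun n => φ n ε h) ∧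
    ∀ h : List (Cycle Y O rmax), ∃ p : Policy Y O rmax, ∀ ε : ℝ, 0 < ε → ∀ n : ℕ,
      condProb ν p h
        {ω | (n : ℝ) * ε <
          (∑ i ∈ Finset.Icc h.length (h.length + n), r i)
            - ∑ i ∈ Finset.Icc h.length (h.length + n), rew (ω i)}
        ≤ ENNReal.ofReal (φ n ε h)

/-! ### Deterministic environments given by a perception function -/

section DetEnv

variable {Y O : Type} {rmax : ℕ}

/-- The history generated by the policy `p` when perceptions are given by `f`. -/
def runHist (f : List (Cycle Y O rmax) → Y → Percept O rmax) (p : Policy Y O rmax) :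
    ℕ → List (Cycle Y O rmax)
  | 0 => []
  | n + 1 => runHist f p n ++ [(p (runHist f p n), f (runHist f p n) (p (runHist f p n)))]

/-- The trajectory generated by the policy `p` when perceptions are given by `f`. -/
def runTraj (f : List (Cycle Y O rmax) → Y → Percept O rmax) (p : Policy Y O rmax) :
    Traj Y O rmax :=
  fun n => (p (runHist f p n), f (runHist f p n) (p (runHist f p n)))

variable (f : List (Cycle Y O rmax) → Y → Percept O rmax) (p : Policy Y O rmax)

lemma runHist_succ (n : ℕ) : runHist f p (n + 1) = runHist f p n ++ [runTraj f p n] := rfl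

@[simp] lemma length_runHist (n : ℕ) : (runHist f p n).length = n := by
  induction n with
  | zero => rfl
  | succ n ih => simp [runHist_succ, ih]

lemma mem_cylSet_append_singleton {A : Type} (ω : ℕ → A) (l : List A) (a : A) :
    ω ∈ cylSet (l ++ [a]) ↔ ω ∈ cylSet l ∧ ω l.length = a := by
  simp only [cylSet, Set.mem_ofPred_eq, Fin.forall_iff, List.get_eq_getElem]
  constructor
  · intro H
    refine ⟨fun i hi => ?_, ?_⟩
    · rw [H i (by simp; omega), List.getElem_append_left hi]
    · rw [H l.length (by simp)]
      simp
  · rintro ⟨H, rfl⟩ i hi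
    rw [List.length_append, List.length_singleton] at hi
    rcases Nat.lt_succ_iff_lt_or_eq.1 hi with hi | rfl
    · rw [H i hi, List.getElem_append_left hi]
    · simp

lemma runHist_length_of_mem_cylSet (l : List (Cycle Y O rmax))
    (hl : runTraj f p ∈ cylSet l) : runHist f p l.length = l := by
  induction l using List.reverseRecOn with
  | nil => rfl
  | append_singleton l a ih =>
    obtain ⟨h₁, h₂⟩ := (mem_cylSet_append_singleton _ _ _).1 hl
    rw [List.length_append, List.length_singleton, runHist_succ, ih h₁, h₂]

instance : MeasurableSingletonClass (Cycle Y O rmax) := ⟨fun _ => trivial⟩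

lemma dirac_eq_one_iff (ω : Traj Y O rmax) (s : Set (Traj Y O rmax)) :
    Measure.dirac ω s = 1 ↔ ω ∈ s := by
  by_cases h : ω ∈ s <;> simp [h]

/-- The deterministic environment whose perceptions are given by `f`. -/
def detEnv [Fintype Y] [Fintype O] (f : List (Cycle Y O rmax) → Y → Percept O rmax) :
    Environment Y O rmax where
  cond h y x := if x = f h y then 1 else 0
  cond_nonneg h y x := by split_ifs <;> norm_num
  cond_sum_one h y := by simp
  P p := Measure.dirac (runTraj f p)
  P_prob p := inferInstance
  P_cyl p h z := by
    by_cases hh : runTraj f p ∈ cylSet h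
    · have hz : runTraj f p h.length = (p h, f h (p h)) := by
        simp only [runTraj, runHist_length_of_mem_cylSet f p h hh]
      obtain ⟨y, x⟩ := z
      simp only [Measure.dirac_apply, Set.indicator_apply, mem_cylSet_append_singleton, hh, hz,
        Prod.mk.injEq, true_and, if_true, Pi.one_apply, one_mul]
      by_cases hy : y = p h
      · subst hy
        by_cases hx : x = f h (p h)
        · simp [hx]
        · simp [hx, Ne.symm hx]
      · simp [hy, Ne.symm hy]
    · simp [Measure.dirac_apply, mem_cylSet_append_singleton, hh]

lemma rew_nonneg (z : Cycle Y O rmax) : 0 ≤ rew z := Nat.cast_nonneg _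

lemma rew_le (z : Cycle Y O rmax) : rew z ≤ rmax := by
  unfold rew
  exact_mod_cast Nat.lt_succ_iff.1 z.2.1.2

lemma limsup_avg_le {ω : Traj Y O rmax} {V : ℝ} (hω : ∀ i, rew (ω i) ≤ V) :
    limsup (avg ω) atTop ≤ V := by
  have h₀ : ∀ m, 0 ≤ avg ω m := fun m =>
    div_nonneg (Finset.sum_nonneg fun i _ => rew_nonneg _) (Nat.cast_nonneg _)
  refine limsup_le_of_le (isBoundedUnder_of ⟨0, h₀⟩).isCoboundedUnder_le
    (Eventually.of_forall fun m => ?_)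
  refine div_le_of_le_mul₀ (Nat.cast_nonneg _) ((rew_nonneg _).trans (hω 0)) ?_
  calc ∑ i ∈ Finset.range m, rew (ω i) ≤ ∑ _i ∈ Finset.range m, V :=
        Finset.sum_le_sum fun i _ => hω i
    _ = V * m := by simp [mul_comm]

lemma tendsto_avg {ω : Traj Y O rmax} {V : ℝ} (hω : ∀ᶠ i in atTop, rew (ω i) = V) :
    Tendsto (avg ω) atTop (nhds V) := by
  have h : Tendsto (fun i => rew (ω i)) atTop (nhds V) :=
    tendsto_const_nhds.congr' (hω.mono fun _ hi => hi.symm)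
  refine h.cesaro.congr fun m => ?_
  rw [avg, div_eq_inv_mul]

lemma sum_sub_sum_le {u : ℕ → ℝ} {V : ℝ} {N : ℕ} (hV : 0 ≤ V) (hu : ∀ i, 0 ≤ u i)
    (hN : ∀ i, N ≤ i → V ≤ u i) (s : Finset ℕ) :
    ∑ _i ∈ s, V - ∑ i ∈ s, u i ≤ N * V := by
  rw [← Finset.sum_sub_distrib]
  calc ∑ i ∈ s, (V - u i) ≤ ∑ i ∈ s, if i < N then V else 0 := by
        refine Finset.sum_le_sum fun i _ => ?_
        split_ifs with hi
        · linarith [hu i]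
        · linarith [hN i (not_lt.1 hi)]
    _ = ∑ i ∈ s with i < N, V := (Finset.sum_filter _ _).symm
    _ ≤ ∑ _i ∈ Finset.range N, V := by
        refine Finset.sum_le_sum_of_subset_of_nonneg (fun i hi => ?_) fun _ _ _ => hV
        exact Finset.mem_range.2 (Finset.mem_filter.1 hi).2
    _ = N * V := by simp

variable [Fintype Y] [Fintype O]

lemma valueIs_detEnv_iff (V : ℝ) :
    ValueIs (detEnv f) p V ↔ Tendsto (avg (runTraj f p)) atTop (nhds V) :=
  dirac_eq_one_iff _ _

lemma deterministic_detEnv : Deterministic (detEnv f) := fun h y x => by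
  by_cases hx : x = f h y <;> simp [detEnv, hx]

lemma condProb_detEnv_le (h : List (Cycle Y O rmax)) (A : Set (Traj Y O rmax)) :
    condProb (detEnv f) p h A ≤
      if runTraj f (replacePolicy h p) ∈ A then 1 else 0 := by
  split_ifs with hA
  · by_cases h₀ : (detEnv f).P (replacePolicy h p) (cylSet h) = 0
    · rw [condProb, condMeasure, ProbabilityTheory.cond_eq_zero_of_meas_eq_zero h₀]
      simp
    · have := (detEnv f).P_prob (replacePolicy h p)
      have : IsProbabilityMeasure (condMeasure (detEnv f) p h) :=
        ProbabilityTheory.cond_isProbabilityMeasure h₀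
      exact prob_le_one
  · refine le_of_eq ((ProbabilityTheory.cond_absolutelyContinuous :
      condMeasure (detEnv f) p h ≪ _) ?_)
    simp [detEnv, hA]

variable {f p} {V : ℝ}

lemma isOptimalValue_detEnv (hf : ∀ h y, rew (y, f h y) ≤ V)
    (hp : ∀ᶠ i in atTop, V ≤ rew (runTraj f p i)) : IsOptimalValue (detEnv f) V := by
  refine ⟨p, (valueIs_detEnv_iff _ _ _).2 (tendsto_avg ?_), fun q => ?_⟩
  · exact hp.mono fun i hi => le_antisymm (hf _ _) hi
  · exact (dirac_eq_one_iff _ _).2 (limsup_avg_le fun i => hf _ _)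

lemma valueStableRelaxed_detEnv (hV : IsOptimalValue (detEnv f) V)
    (hV_mem : V ∈ Set.Icc (0 : ℝ) rmax)
    (hp : ∀ h, ∀ᶠ i in atTop, V ≤ rew (runTraj f (replacePolicy h p) i)) :
    ValueStableRelaxed (detEnv f) := by
  choose N hN using fun h => eventually_atTop.1 (hp h)
  refine ⟨V, fun _ => V, fun n ε h => if (n : ℝ) * ε < N h * V then 1 else 0, hV,
    fun _ => hV_mem, ?_, fun ε hε h => ?_, fun h => ⟨p, fun ε _ n => ?_⟩⟩
  · exact (tendsto_const_nhds (x := V)).cesaro.congr fun m => by rw [div_eq_inv_mul]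
  · obtain ⟨M, hM⟩ := exists_nat_gt (N h * V / ε)
    refine summable_of_ne_finset_zero (s := Finset.range M) fun n hn => if_neg (not_lt.2 ?_)
    rw [Finset.mem_range, not_lt] at hn
    have : (M : ℝ) ≤ n := by exact_mod_cast hn
    exact ((div_lt_iff₀ hε).1 (hM.trans_le this)).le
  · refine (condProb_detEnv_le f p h _).trans ?_
    split_ifs with hn
    · beta_reduce
      rw [if_pos (lt_of_lt_of_le hn
          (sum_sub_sum_le hV_mem.1 (fun i => rew_nonneg _) (hN h) _)), ENNReal.ofReal_one]
    · exact zero_le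

end DetEnv

/-! ### The counterexample -/

/-- Action `true` earns the safe reward `1`; action `false` earns `2` on histories satisfying
`c`, and `0` on all others. -/
def bonusPercept (c : List (Cycle Bool Unit 2) → Prop) (h : List (Cycle Bool Unit 2)) (y : Bool) :
    Percept Unit 2 :=
  (if y then 1 else if c h then 2 else 0, ())

/-- The number of times the risky action `false` was taken in a history. -/
def riskyCount (h : List (Cycle Bool Unit 2)) : ℕ := h.countP fun z => !z.1

/-- The history has length at least `s`, and at least half of its actions are risky. -/
def MostlyRisky (s : ℕ) (h : List (Cycle Bool Unit 2)) : Prop :=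
  s ≤ h.length ∧ h.length ≤ 2 * riskyCount h

lemma riskyCount_append_singleton (h : List (Cycle Bool Unit 2)) (z : Cycle Bool Unit 2) :
    riskyCount (h ++ [z]) = riskyCount h + if z.1 then 0 else 1 := by
  obtain ⟨_ | _, x⟩ := z <;> simp [riskyCount]

lemma replacePolicy_of_le {Y O : Type} [Fintype Y] [Fintype O] {rmax : ℕ}
    {h l : List (Cycle Y O rmax)} (p : Policy Y O rmax) (hl : h.length ≤ l.length) :
    replacePolicy h p l = p l := dif_neg (not_lt.2 hl)

lemma replacePolicy_nil {Y O : Type} [Fintype Y] [Fintype O] {rmax : ℕ}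
    (p : Policy Y O rmax) : replacePolicy [] p = p :=
  funext fun _ => replacePolicy_of_le p (Nat.zero_le _)

lemma rew_runTraj_safe (h : List (Cycle Bool Unit 2)) (i : ℕ) (hi : h.length ≤ i)
    (c : List (Cycle Bool Unit 2) → Prop) :
    rew (runTraj (bonusPercept c) (replacePolicy h fun _ => true) i) = 1 := by
  simp [runTraj, replacePolicy_of_le, hi, bonusPercept, rew]

lemma sub_le_riskyCount (f : List (Cycle Bool Unit 2) → Bool → Percept Unit 2)
    (h : List (Cycle Bool Unit 2)) (i : ℕ) :
    i - h.length ≤ riskyCount (runHist f (replacePolicy h fun _ => false) i) := by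
  induction i with
  | zero => simp
  | succ i ih =>
    rw [runHist_succ, riskyCount_append_singleton]
    by_cases hi : h.length ≤ i
    · simp only [runTraj, replacePolicy_of_le, hi, length_runHist]
      simp only [Bool.false_eq_true, if_false]
      omega
    · omega

lemma rew_runTraj_risky (s : ℕ) (h : List (Cycle Bool Unit 2)) (i : ℕ)
    (hs : s ≤ i) (hi : 2 * h.length ≤ i) :
    rew (runTraj (bonusPercept (MostlyRisky s)) (replacePolicy h fun _ => false) i) = 2 := by
  have hc : MostlyRisky s
      (runHist (bonusPercept (MostlyRisky s)) (replacePolicy h fun _ => false) i) := by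
    have := sub_le_riskyCount (bonusPercept (MostlyRisky s)) h i
    refine ⟨by simpa using hs, ?_⟩
    rw [length_runHist]
    omega
  have hi' : h.length ≤ i := by omega
  simp [runTraj, replacePolicy_of_le, hi', bonusPercept, rew, hc]

lemma isOptimalValue_safe : IsOptimalValue (detEnv (bonusPercept fun _ => False)) 1 := by
  refine isOptimalValue_detEnv (p := fun _ => true) (fun h y => ?_) ?_
  · cases y <;> simp [bonusPercept, rew]
  · refine Eventually.of_forall fun i => ?_
    have := rew_runTraj_safe [] i (Nat.zero_le _) fun _ => False
    rw [replacePolicy_nil] at this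
    exact this.ge

lemma valueStableRelaxed_safe : ValueStableRelaxed (detEnv (bonusPercept fun _ => False)) :=
  valueStableRelaxed_detEnv (p := fun _ => true) isOptimalValue_safe (by norm_num) fun h =>
    eventually_atTop.2 ⟨h.length, fun i hi => (rew_runTraj_safe h i hi _).ge⟩

lemma eventually_two_le_rew_risky (s : ℕ) (h : List (Cycle Bool Unit 2)) :
    ∀ᶠ i in atTop, (2 : ℝ) ≤
      rew (runTraj (bonusPercept (MostlyRisky s)) (replacePolicy h fun _ => false) i) :=
  eventually_atTop.2 ⟨s + 2 * h.length, fun i hi =>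
    (rew_runTraj_risky s h i (by omega) (by omega)).ge⟩

lemma isOptimalValue_risky (s : ℕ) :
    IsOptimalValue (detEnv (bonusPercept (MostlyRisky s))) 2 := by
  refine isOptimalValue_detEnv (p := fun _ => false) (fun h y => by exact_mod_cast rew_le (y, bonusPercept (MostlyRisky s) h y)) ?_
  have := eventually_two_le_rew_risky s []
  rwa [replacePolicy_nil] at this

lemma valueStableRelaxed_risky (s : ℕ) :
    ValueStableRelaxed (detEnv (bonusPercept (MostlyRisky s))) :=
  valueStableRelaxed_detEnv (p := fun _ => false) (isOptimalValue_risky s) (by norm_num)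
    (eventually_two_le_rew_risky s)

lemma ValueStableRelaxed.explorable {Y O : Type} [Fintype Y] [Fintype O] {rmax : ℕ}
    {ν : Environment Y O rmax} (h : ValueStableRelaxed ν) : Explorable ν :=
  let ⟨V, _, _, hV, _⟩ := h
  ⟨V, hV⟩

lemma sum_rew_safe (p : Policy Bool Unit 2) (m : ℕ) :
    ∑ i ∈ Finset.range m, rew (runTraj (bonusPercept fun _ => False) p i)
      = m - riskyCount (runHist (bonusPercept fun _ => False) p m) := by
  induction m with
  | zero => simp [runHist, riskyCount]
  | succ m ih =>
    rw [Finset.sum_range_succ, ih, runHist_succ, riskyCount_append_singleton]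
    cases hy : p (runHist (bonusPercept fun _ => False) p m) <;>
      simp [runTraj, hy, bonusPercept, rew]; ring

lemma bonusPercept_of_not {c : List (Cycle Bool Unit 2) → Prop} {h : List (Cycle Bool Unit 2)}
    (hc : ¬ c h) (y : Bool) : bonusPercept c h y = bonusPercept (fun _ => False) h y := by
  simp [bonusPercept, hc]

lemma runHist_bonusPercept_eq {c : List (Cycle Bool Unit 2) → Prop} {p : Policy Bool Unit 2}
    (hc : ∀ n, ¬ c (runHist (bonusPercept fun _ => False) p n)) (n : ℕ) :
    runHist (bonusPercept c) p n = runHist (bonusPercept fun _ => False) p n := by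
  induction n with
  | zero => rfl
  | succ n ih => simp only [runHist, ih, bonusPercept_of_not (hc n)]

lemma runTraj_bonusPercept_eq {c : List (Cycle Bool Unit 2) → Prop} {p : Policy Bool Unit 2}
    (hc : ∀ n, ¬ c (runHist (bonusPercept fun _ => False) p n)) :
    runTraj (bonusPercept c) p = runTraj (bonusPercept fun _ => False) p := by
  funext n
  simp only [runTraj, runHist_bonusPercept_eq hc, bonusPercept_of_not (hc n)]

/-- A policy attaining the safe value never triggers the bonus of some risky environment. -/
lemma exists_forall_not_mostlyRisky {p : Policy Bool Unit 2}
    (hp : Tendsto (avg (runTraj (bonusPercept fun _ => False) p)) atTop (nhds 1)) :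
    ∃ s, ∀ n, ¬ MostlyRisky s (runHist (bonusPercept fun _ => False) p n) := by
  obtain ⟨s, hs⟩ := eventually_atTop.1
    ((hp.eventually (lt_mem_nhds (show (1 / 2 : ℝ) < 1 by norm_num))).and
      (eventually_gt_atTop 0))
  refine ⟨s, fun n hn => ?_⟩
  rw [MostlyRisky, length_runHist] at hn
  obtain ⟨h₁, h₂⟩ := hs n hn.1
  rw [avg, sum_rew_safe, lt_div_iff₀ (by exact_mod_cast h₂)] at h₁
  have h₃ : (n : ℝ) ≤ 2 * riskyCount (runHist (bonusPercept fun _ => False) p n) := by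
    exact_mod_cast hn.2
  linarith

/-- **Uniformity of convergence in the value-stability condition cannot be dropped.**
If `φ(n,ε)` is allowed to depend additionally on the history `z_{<k}`, then the
self-optimizing theorem fails: there is a countable class of deterministic explorable
environments, each satisfying the history-dependent relaxation of value-stability (with
`d(k,ε) ≡ 0`), for which no self-optimizing policy exists. -/
theorem history_dependent_phi_insufficient :
    ∃ C : Set (Environment Bool Unit 2), C.Countable ∧
      (∀ ν ∈ C, Deterministic ν ∧ Explorable ν ∧ ValueStableRelaxed ν) ∧
      ¬ ∃ p : Policy Bool Unit 2, SelfOptimizing p C := by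
  refine ⟨insert (detEnv (bonusPercept fun _ => False))
    (Set.range fun s => detEnv (bonusPercept (MostlyRisky s))),
    (Set.countable_range _).insert _, ?_, ?_⟩
  · rintro ν (rfl | ⟨s, rfl⟩)
    · exact ⟨deterministic_detEnv _, valueStableRelaxed_safe.explorable, valueStableRelaxed_safe⟩
    · exact ⟨deterministic_detEnv _, (valueStableRelaxed_risky s).explorable,
        valueStableRelaxed_risky s⟩
  · rintro ⟨p, hp⟩
    have h₁ := (valueIs_detEnv_iff _ _ _).1
      (hp _ (Set.mem_insert _ _) 1 isOptimalValue_safe)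
    obtain ⟨s, hs⟩ := exists_forall_not_mostlyRisky h₁
    have h₂ := (valueIs_detEnv_iff _ _ _).1
      (hp _ (Set.mem_insert_of_mem _ ⟨s, rfl⟩) 2 (isOptimalValue_risky s))
    rw [runTraj_bonusPercept_eq hs] at h₂
    exact absurd (tendsto_nhds_unique h₁ h₂) (by norm_num)

end RL
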